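/- Let 1 ≤ b ≤ c < a ≤ d with b < d be integers, and β, γ, B₀, C₀ reals with 0 < β ≤ γ. Suppose ψ(T) = T^{−β}(log(T+2))^{B₀} and φ(T) = T^{−γ}(log(T+2))^{C₀} are decreasing on [1,∞) and ψ(T) ≤ T^{−b/(d−b)} for all T ≥ 1. Let B be a b-dimensional linear subspace of ℝ^d with dist(z, B) ≥ ψ(|z|) for every nonzero z ∈ ℤ^d, and let A ⊇ B be any a-dimensional linear subspace. If either γ(a−c) > β(a−b) + c − b, or γ(a−c) = β(a−b) + c − b and C₀(a−c) − B₀(a−b) < −1, then for Lebesgue-almost every Θ ∈ ℝ^{(a−c)×c} there are only finitely many z ∈ ℤ^d \ {0} with dist(z, C(Θ)) < φ(|z|); hence almost every c-dimensional subspace of A is (ρφ)-badly approximable for some ρ > 0. -/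

import Mathlib

open MeasureTheory Filter

noncomputable section

/-- The sup-norm of a vector in Euclidean space. -/
def supNorm {d : ℕ} (w : EuclideanSpace ℝ (Fin d)) : ℝ := ⨆ i, |w i|

/-- The point of `ℝ^d` (with Euclidean metric) corresponding to an integer vector. -/
def intVec {d : ℕ} (z : Fin d → ℤ) : EuclideanSpace ℝ (Fin d) :=
  (WithLp.equiv 2 (Fin d → ℝ)).symm (fun i => (z i : ℝ))

/-- The irrationality measure function `ψ_B` of a linear subspace of `ℝ^d`:
`ψ_B(t) = inf { dist(z, B) : z ∈ ℤ^d, 1 ≤ |z| < t }`. -/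
def psiSub {d : ℕ} (B : Submodule ℝ (EuclideanSpace ℝ (Fin d))) (t : ℝ) : ℝ :=
  sInf ((fun z : Fin d → ℤ =>
      Metric.infDist (intVec z) (B : Set (EuclideanSpace ℝ (Fin d)))) ''
    {z | 1 ≤ supNorm (intVec z) ∧ supNorm (intVec z) < t})

/-- The Diophantine exponent of a linear subspace of `ℝ^d`:
`ω(B) = sup { γ : liminf_{t→∞} t^γ ψ_B(t) < ∞ }`, as an extended real number. -/
def diophExp {d : ℕ} (B : Submodule ℝ (EuclideanSpace ℝ (Fin d))) : EReal :=
  sSup {x : EReal | ∃ γ : ℝ, x = (γ : EReal) ∧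
    Filter.liminf (fun t : ℝ => ENNReal.ofReal (t ^ γ * psiSub B t)) Filter.atTop < ⊤}

/-- The graph subspace `C(Θ)` of an `(a-c)×c` matrix `Θ`, relative to an orthonormal
basis `e` of an `a`-dimensional subspace of `ℝ^d`:
`C(Θ) = { ∑ x_j e_j + ∑_i (∑_j θ_{ij} x_j) e_{c+i} : x ∈ ℝ^c }`. -/
def graphSub (d a c : ℕ) (hca : c ≤ a) (e : Fin a → EuclideanSpace ℝ (Fin d))
    (Θ : Fin (a - c) → Fin c → ℝ) : Submodule ℝ (EuclideanSpace ℝ (Fin d)) :=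
  Submodule.span ℝ {v | ∃ x : Fin c → ℝ,
    v = (∑ j : Fin c, x j • e (Fin.castLE hca j)) +
        ∑ i : Fin (a - c), (∑ j : Fin c, Θ i j * x j) • e ⟨c + i.1, by have := i.2; omega⟩}

lemma abs_le_supNorm {d : ℕ} (w : EuclideanSpace ℝ (Fin d)) (i : Fin d) : |w i| ≤ supNorm w :=
  le_ciSup (f := fun i => |w i|) (Set.finite_range _).bddAbove i

lemma supNorm_nonneg {d : ℕ} (w : EuclideanSpace ℝ (Fin d)) : 0 ≤ supNorm w :=
  Real.iSup_nonneg fun _ => abs_nonneg _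

lemma supNorm_le {d : ℕ} {w : EuclideanSpace ℝ (Fin d)} {r : ℝ} (hr : 0 ≤ r)
    (h : ∀ i, |w i| ≤ r) : supNorm w ≤ r :=
  Real.iSup_le h hr

lemma supNorm_le_norm {d : ℕ} (w : EuclideanSpace ℝ (Fin d)) : supNorm w ≤ ‖w‖ :=
  supNorm_le (norm_nonneg _) fun i => PiLp.norm_apply_le w i

lemma norm_le_mul_supNorm {d : ℕ} (w : EuclideanSpace ℝ (Fin d)) : ‖w‖ ≤ d * supNorm w := by
  rw [EuclideanSpace.norm_eq]
  have h0 := supNorm_nonneg w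
  refine Real.sqrt_le_iff.2 ⟨by positivity, ?_⟩
  calc ∑ i, ‖w i‖ ^ 2 ≤ ∑ _i : Fin d, supNorm w ^ 2 := by
        gcongr with i
        exact abs_le_supNorm w i
    _ = d * supNorm w ^ 2 := by simp
    _ ≤ (d * supNorm w) ^ 2 := by
        rw [mul_pow]
        gcongr
        exact_mod_cast Nat.le_self_pow two_ne_zero d

lemma supNorm_sub_le {d : ℕ} (v w : EuclideanSpace ℝ (Fin d)) :
    supNorm (v - w) ≤ supNorm v + supNorm w :=
  supNorm_le (add_nonneg (supNorm_nonneg v) (supNorm_nonneg w)) fun i =>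
    (abs_sub (v i) (w i)).trans (add_le_add (abs_le_supNorm v i) (abs_le_supNorm w i))

lemma intVec_sub {d : ℕ} (z z' : Fin d → ℤ) : intVec (z - z') = intVec z - intVec z' := by
  ext i
  simp [intVec]

lemma one_le_supNorm_intVec {d : ℕ} {z : Fin d → ℤ} (hz : z ≠ 0) : 1 ≤ supNorm (intVec z) := by
  obtain ⟨i, hi⟩ := Function.ne_iff.1 hz
  refine le_trans ?_ (abs_le_supNorm (intVec z) i)
  have : (1 : ℤ) ≤ |z i| := Int.one_le_abs hi
  simpa [intVec] using (by exact_mod_cast this : (1 : ℝ) ≤ |(z i : ℝ)|)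

lemma finite_setOf_supNorm_intVec_le (d : ℕ) (T : ℝ) :
    {z : Fin d → ℤ | supNorm (intVec z) ≤ T}.Finite := by
  refine (Set.finite_Icc (fun _ : Fin d => -⌈T⌉) (fun _ => ⌈T⌉)).subset fun z hz => ?_
  have h : ∀ i, |z i| ≤ ⌈T⌉ := fun i => by
    have h1 : |(z i : ℝ)| ≤ T := (abs_le_supNorm (intVec z) i).trans hz
    exact_mod_cast h1.trans (Int.le_ceil T)
  exact ⟨fun i => (abs_le.1 (h i)).1, fun i => (abs_le.1 (h i)).2⟩

/-- Distances to a subspace `B ≤ A` are controlled by the distance to `A` together with the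
coordinates in an orthonormal basis of the orthogonal complement of `B` in `A`. -/
lemma exists_infDist_le_infDist_add_sum {E : Type*} [NormedAddCommGroup E]
    [InnerProductSpace ℝ E] [FiniteDimensional ℝ E] {A B : Submodule ℝ E} (hBA : B ≤ A) {n : ℕ}
    (hn : Module.finrank ℝ B + n = Module.finrank ℝ A) :
    ∃ w : Fin n → E, (∀ i, ‖w i‖ = 1) ∧ ∀ x,
      Metric.infDist x (B : Set E) ≤ Metric.infDist x (A : Set E) + ∑ i, |inner ℝ (w i) x| := by
  have hW : Module.finrank ℝ (Bᗮ ⊓ A : Submodule ℝ E) = n := by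
    have := Submodule.finrank_add_inf_finrank_orthogonal hBA
    omega
  let o := (stdOrthonormalBasis ℝ (Bᗮ ⊓ A : Submodule ℝ E)).reindex (finCongr hW)
  refine ⟨fun i => (o i : E), fun i => o.orthonormal.1 i, fun x => ?_⟩
  obtain ⟨p, hpA, hp⟩ : ∃ p ∈ A, Metric.infDist x (A : Set E) = ‖x - p‖ ∧
      ∀ v ∈ A, inner ℝ v p = inner ℝ v x := by
    refine ⟨A.starProjection x, A.starProjection_apply_mem x, ?_, fun v hv => ?_⟩
    · rw [Submodule.starProjection_minimal, Metric.infDist_eq_iInf]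
      simp [dist_eq_norm]
    · have := A.starProjection_inner_eq_zero x v hv
      rw [inner_sub_left, real_inner_comm, real_inner_comm v] at this
      linarith
  have hq : ∀ v ∈ B, inner ℝ v (B.starProjection x) = inner ℝ v x := fun v hv => by
    have := B.starProjection_inner_eq_zero x v hv
    rw [inner_sub_left, real_inner_comm, real_inner_comm v] at this
    linarith
  have hqB := B.starProjection_apply_mem x
  set q := B.starProjection x
  have hu : p - q ∈ (Bᗮ ⊓ A : Submodule ℝ E) := by
    refine ⟨(Submodule.mem_orthogonal _ _).2 fun v hv => ?_, A.sub_mem hpA (hBA hqB)⟩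
    rw [inner_sub_right, hp.2 v (hBA hv), hq v hv, sub_self]
  have hsum : p - q = ∑ i, inner ℝ (o i : E) x • (o i : E) := by
    have := congrArg Subtype.val (o.sum_repr' ⟨p - q, hu⟩)
    refine this.symm.trans ?_
    simp only [Submodule.coe_sum, Submodule.coe_smul, Submodule.coe_inner]
    refine Finset.sum_congr rfl fun i _ => ?_
    rw [inner_sub_right, hp.2 _ (o i).2.2, Submodule.inner_left_of_mem_orthogonal hqB (o i).2.1,
      sub_zero]
  calc Metric.infDist x (B : Set E) ≤ ‖x - q‖ := by
        rw [← dist_eq_norm]; exact Metric.infDist_le_dist_of_mem hqB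
    _ ≤ ‖x - p‖ + ‖p - q‖ := norm_sub_le_norm_sub_add_norm_sub ..
    _ ≤ _ := by
        rw [hp.1, hsum]
        gcongr
        refine (norm_sum_le _ _).trans (Finset.sum_le_sum fun i _ => ?_)
        have : ‖(o i : E)‖ = 1 := o.orthonormal.1 i
        rw [norm_smul, this, mul_one, Real.norm_eq_abs]

lemma card_le_of_separated {ι : Type*} {n : ℕ} (S : Finset ι) (f : ι → Fin n → ℝ) {R s : ℝ}
    (hR : 0 ≤ R) (hs : 0 < s) (hf : ∀ z ∈ S, ∀ i, |f z i| ≤ R)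
    (hsep : ∀ z ∈ S, ∀ z' ∈ S, (∀ i, |f z i - f z' i| < s) → z = z') :
    (S.card : ℝ) ≤ (2 * (R / s) + 3) ^ n := by
  set M : ℤ := ⌈R / s⌉
  have hM : 0 ≤ M := Int.ceil_nonneg (by positivity)
  have hcard : S.card ≤ (Finset.Icc (fun _ : Fin n => -M) (fun _ => M)).card := by
    refine Finset.card_le_card_of_injOn (fun z i => ⌊f z i / s⌋) (fun z hz => ?_) ?_
    · have h : ∀ i, |f z i / s| ≤ M := fun i => by
        rw [abs_div, abs_of_pos hs]
        exact (div_le_div_of_nonneg_right (hf z hz i) hs.le).trans (Int.le_ceil _)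
      simp only [Finset.coe_Icc, Set.mem_Icc, Pi.le_def]
      refine ⟨fun i => Int.le_floor.2 ?_, fun i => ?_⟩
      · push_cast
        exact (abs_le.1 (h i)).1
      · exact_mod_cast (Int.floor_le (f z i / s)).trans (abs_le.1 (h i)).2
    · intro z hz z' hz' h
      refine hsep z hz z' hz' fun i => ?_
      have := Int.abs_sub_lt_one_of_floor_eq_floor (congrFun h i)
      rwa [← sub_div, abs_div, abs_of_pos hs, div_lt_one hs] at this
  rw [Pi.card_Icc] at hcard
  simp only [Int.card_Icc, Finset.prod_const, Finset.card_univ, Fintype.card_fin] at hcard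
  calc (S.card : ℝ) ≤ (((M + 1 - -M).toNat : ℕ) : ℝ) ^ n := by exact_mod_cast hcard
    _ ≤ _ := by
        gcongr
        have h1 : (((M + 1 - -M).toNat : ℕ) : ℝ) = 2 * M + 1 := by
          have : (((M + 1 - -M).toNat : ℕ) : ℤ) = 2 * M + 1 := by omega
          exact_mod_cast this
        rw [h1]
        linarith [Int.ceil_lt_add_one (R / s)]

lemma volume_slab_le {c : ℕ} (u : Fin c → ℝ) (j : Fin c) (hu : u j ≠ 0) (v : ℝ) {ε R : ℝ}
    (hε : 0 ≤ ε) (hR : 0 ≤ R) :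
    volume {θ : Fin c → ℝ | (∀ k, |θ k| ≤ R) ∧ |∑ k, θ k * u k - v| ≤ ε} ≤
      ENNReal.ofReal (|u j|⁻¹ * (2 * ε * (2 * R) ^ (c - 1))) := by
  set f := Matrix.toLin' ((1 : Matrix (Fin c) (Fin c) ℝ).updateRow j u)
  have hdet : LinearMap.det f = u j := by
    rw [LinearMap.det_toLin', ← Matrix.cramer_transpose_apply]
    simp
  let I : Fin c → Set ℝ := fun k => if k = j then Set.Icc (v - ε) (v + ε) else Set.Icc (-R) R
  have hsub : {θ : Fin c → ℝ | (∀ k, |θ k| ≤ R) ∧ |∑ k, θ k * u k - v| ≤ ε} ⊆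
      f ⁻¹' Set.univ.pi I := by
    rintro θ ⟨h1, h2⟩ k -
    have hfk : f θ k = if k = j then ∑ k, θ k * u k else θ k := by
      simp only [f, Matrix.toLin'_apply, Matrix.mulVec, Matrix.updateRow_apply]
      split_ifs
      · simp [dotProduct, mul_comm]
      · simp [dotProduct, Matrix.one_apply]
    simp only [I, hfk]
    split_ifs
    · constructor <;> linarith [abs_le.1 h2]
    · exact ⟨(abs_le.1 (h1 k)).1, (abs_le.1 (h1 k)).2⟩
  refine (measure_mono hsub).trans ?_
  rw [Measure.addHaar_preimage_linearMap volume (by rwa [hdet]), hdet, volume_pi_pi,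
    abs_inv, ENNReal.ofReal_mul (by positivity)]
  gcongr
  have hI : ∀ k, volume (I k) = ENNReal.ofReal (if k = j then 2 * ε else 2 * R) := fun k => by
    simp only [I]
    split_ifs <;> rw [Real.volume_Icc] <;> congr 1 <;> ring
  simp_rw [hI]
  rw [← Finset.mul_prod_erase _ _ (Finset.mem_univ j),
    Finset.prod_congr rfl (g := fun _ => ENNReal.ofReal (2 * R))
      (fun k hk => by rw [if_neg (Finset.ne_of_mem_erase hk)])]
  simp only [if_true, Finset.prod_const, Finset.card_erase_of_mem (Finset.mem_univ j),
    Finset.card_univ, Fintype.card_fin]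
  rw [ENNReal.ofReal_mul (p := 2 * ε) (by positivity), ENNReal.ofReal_pow (by positivity)]

lemma volume_matrix_slab_le {m c : ℕ} (u : Fin c → ℝ) (j : Fin c) (hu : u j ≠ 0)
    (v : Fin m → ℝ) {ε R : ℝ} (hε : 0 ≤ ε) (hR : 0 ≤ R) :
    volume {Θ : Fin m → Fin c → ℝ | (∀ i k, |Θ i k| ≤ R) ∧
        ∀ i, |∑ k, Θ i k * u k - v i| ≤ ε} ≤
      ENNReal.ofReal (|u j|⁻¹ * (2 * ε * (2 * R) ^ (c - 1))) ^ m := by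
  have hset : {Θ : Fin m → Fin c → ℝ | (∀ i k, |Θ i k| ≤ R) ∧
      ∀ i, |∑ k, Θ i k * u k - v i| ≤ ε} =
      Set.univ.pi fun i => {θ | (∀ k, |θ k| ≤ R) ∧ |∑ k, θ k * u k - v i| ≤ ε} := by
    ext Θ
    simp [Set.mem_pi, forall_and]
  rw [hset, volume_pi_pi]
  refine (Finset.prod_le_prod' fun i _ => volume_slab_le u j hu (v i) hε hR).trans_eq ?_
  simp

lemma exists_eq_of_mem_graphSub {d a c : ℕ} {hca : c ≤ a} {e : Fin a → EuclideanSpace ℝ (Fin d)}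
    {Θ : Fin (a - c) → Fin c → ℝ} {y : EuclideanSpace ℝ (Fin d)}
    (hy : y ∈ graphSub d a c hca e Θ) :
    ∃ x : Fin c → ℝ, y = (∑ j : Fin c, x j • e (Fin.castLE hca j)) +
        ∑ i : Fin (a - c), (∑ j : Fin c, Θ i j * x j) • e ⟨c + i.1, by have := i.2; omega⟩ := by
  induction hy using Submodule.span_induction with
  | mem y hy => exact hy
  | zero => exact ⟨0, by simp⟩
  | add y y' _ _ hy hy' =>
    obtain ⟨x, rfl⟩ := hy
    obtain ⟨x', rfl⟩ := hy'
    refine ⟨x + x', ?_⟩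
    simp only [Pi.add_apply, add_smul, mul_add, Finset.sum_add_distrib]
    abel
  | smul r y _ hy =>
    obtain ⟨x, rfl⟩ := hy
    refine ⟨r • x, ?_⟩
    simp only [Pi.smul_apply, smul_eq_mul, smul_add, Finset.smul_sum, mul_smul,
      Finset.sum_smul, mul_left_comm]

lemma graphSub_le_span (d a c : ℕ) (hca : c ≤ a) (e : Fin a → EuclideanSpace ℝ (Fin d))
    (Θ : Fin (a - c) → Fin c → ℝ) :
    graphSub d a c hca e Θ ≤ Submodule.span ℝ (Set.range e) := by
  intro y hy
  obtain ⟨x, rfl⟩ := exists_eq_of_mem_graphSub hy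
  have h : ∀ k, e k ∈ Submodule.span ℝ (Set.range e) := fun k =>
    Submodule.subset_span ⟨k, rfl⟩
  exact add_mem (sum_mem fun j _ => Submodule.smul_mem _ _ (h _))
    (sum_mem fun i _ => Submodule.smul_mem _ _ (h _))

/-- If `z` is `η`-close to the graph of a matrix `Θ` with entries bounded by `R`, then `Θ` lies in
an intersection of slabs of width of order `η`, and `z` is controlled by its first `c`
coordinates. -/
lemma of_infDist_graphSub_le {d a c : ℕ} {hca : c ≤ a} {e : Fin a → EuclideanSpace ℝ (Fin d)}
    (he : Orthonormal ℝ e) {Θ : Fin (a - c) → Fin c → ℝ} {R : ℝ} (hR : 0 ≤ R)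
    (hΘ : ∀ i j, |Θ i j| ≤ R) {z : EuclideanSpace ℝ (Fin d)} {η : ℝ}
    (hz : Metric.infDist z (graphSub d a c hca e Θ : Set (EuclideanSpace ℝ (Fin d))) ≤ η) :
    (∀ i : Fin (a - c), |∑ j, Θ i j * inner ℝ (e (Fin.castLE hca j)) z -
        inner ℝ (e ⟨c + i.1, by have := i.2; omega⟩) z| ≤ (1 + c * R) * η) ∧
      ‖z‖ ≤ η + (1 + (a - c : ℕ) * R) * ∑ j, (|inner ℝ (e (Fin.castLE hca j)) z| + η) := by
  obtain ⟨y, hy, hyz⟩ := IsClosed.exists_infDist_eq_dist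
    (Submodule.closed_of_finiteDimensional (graphSub d a c hca e Θ)) ⟨0, zero_mem _⟩ z
  rw [hyz, dist_eq_norm] at hz
  obtain ⟨x, hx⟩ := exists_eq_of_mem_graphSub hy
  have hfst : ∀ j, inner ℝ (e (Fin.castLE hca j)) y = x j := fun j => by
    rw [hx]
    simp only [inner_add_right, inner_sum, inner_smul_right, orthonormal_iff_ite.1 he]
    have : ∀ i : Fin (a - c), Fin.castLE hca j ≠ ⟨c + i.1, by have := i.2; omega⟩ := fun i h => by
      have := congrArg Fin.val h
      have := j.2
      simp only [Fin.val_castLE] at *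
      omega
    simp [this]
  have hsnd : ∀ i : Fin (a - c), inner ℝ (e ⟨c + i.1, by have := i.2; omega⟩) y =
      ∑ j, Θ i j * x j := fun i => by
    rw [hx]
    simp only [inner_add_right, inner_sum, inner_smul_right, orthonormal_iff_ite.1 he]
    have : ∀ j : Fin c, (⟨c + i.1, by have := i.2; omega⟩ : Fin a) ≠ Fin.castLE hca j :=
      fun j h => by
        have := congrArg Fin.val h
        have := j.2
        simp only [Fin.val_castLE] at *
        omega
    simp [this, Fin.val_inj]
  have hclose : ∀ k, |inner ℝ (e k) z - inner ℝ (e k) y| ≤ η := fun k => by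
    rw [← inner_sub_right]
    refine (abs_real_inner_le_norm _ _).trans ?_
    rw [he.1 k, one_mul]
    exact hz
  refine ⟨fun i => ?_, ?_⟩
  · have hid : ∑ j, Θ i j * inner ℝ (e (Fin.castLE hca j)) z -
        inner ℝ (e ⟨c + i.1, by have := i.2; omega⟩) z =
        ∑ j, Θ i j * (inner ℝ (e (Fin.castLE hca j)) z - inner ℝ (e (Fin.castLE hca j)) y) -
        (inner ℝ (e ⟨c + i.1, by have := i.2; omega⟩) z -
          inner ℝ (e ⟨c + i.1, by have := i.2; omega⟩) y) := by
      simp only [hfst, hsnd, mul_sub, Finset.sum_sub_distrib]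
      ring
    rw [hid]
    refine (abs_sub _ _).trans ?_
    have h1 : |∑ j, Θ i j *
        (inner ℝ (e (Fin.castLE hca j)) z - inner ℝ (e (Fin.castLE hca j)) y)| ≤ c * (R * η) := by
      refine (Finset.abs_sum_le_sum_abs _ _).trans ?_
      refine (Finset.sum_le_card_nsmul _ _ (R * η) fun j _ => ?_).trans_eq (by simp)
      rw [abs_mul]
      exact mul_le_mul (hΘ i j) (hclose _) (abs_nonneg _) hR
    linarith [hclose ⟨c + i.1, by have := i.2; omega⟩]
  · have hxj : ∑ j, |x j| ≤ ∑ j, (|inner ℝ (e (Fin.castLE hca j)) z| + η) := by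
      refine Finset.sum_le_sum fun j _ => ?_
      have h1 := hclose (Fin.castLE hca j)
      rw [hfst, abs_sub_comm] at h1
      linarith [abs_sub_abs_le_abs_sub (x j) (inner ℝ (e (Fin.castLE hca j)) z)]
    have hy' : ‖y‖ ≤ (1 + (a - c : ℕ) * R) * ∑ j, |x j| := by
      rw [hx, add_mul, one_mul]
      refine (norm_add_le _ _).trans (add_le_add ?_ ?_)
      · refine (norm_sum_le _ _).trans_eq (Finset.sum_congr rfl fun j _ => ?_)
        rw [norm_smul, he.1, mul_one, Real.norm_eq_abs]
      · refine (norm_sum_le _ _).trans ?_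
        refine (Finset.sum_le_card_nsmul _ _ (R * ∑ j, |x j|) fun i _ => ?_).trans_eq
          (by simp [mul_assoc])
        rw [norm_smul, he.1, mul_one, Real.norm_eq_abs, Finset.mul_sum]
        refine (Finset.abs_sum_le_sum_abs _ _).trans (Finset.sum_le_sum fun j _ => ?_)
        rw [abs_mul]
        exact mul_le_mul_of_nonneg_right (hΘ i j) (abs_nonneg _)
    have hzy : ‖z‖ ≤ ‖z - y‖ + ‖y‖ := by simpa using norm_add_le (z - y) y
    have := mul_le_mul_of_nonneg_left hxj (by positivity : 0 ≤ 1 + ((a - c : ℕ) : ℝ) * R)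
    linarith

lemma exists_volume_infDist_graphSub_le {d a c : ℕ} (hc : 1 ≤ c) (hca : c ≤ a)
    {e : Fin a → EuclideanSpace ℝ (Fin d)} (he : Orthonormal ℝ e) {R : ℝ} (hR : 0 ≤ R) :
    ∃ K : ℝ, 0 < K ∧ ∀ (z : EuclideanSpace ℝ (Fin d)) (η : ℝ), 0 ≤ η → 0 < ‖z‖ → K * η ≤ ‖z‖ →
      volume {Θ : Fin (a - c) → Fin c → ℝ | (∀ i j, |Θ i j| ≤ R) ∧
        Metric.infDist z (graphSub d a c hca e Θ : Set (EuclideanSpace ℝ (Fin d))) ≤ η} ≤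
      ENNReal.ofReal (K * (η / ‖z‖)) ^ (a - c) := by
  set L : ℝ := (1 + (a - c : ℕ) * R) * c with hL
  have hc' : (0 : ℝ) < c := by exact_mod_cast hc
  have hL0 : 0 < L := by positivity
  set M : ℝ := 2 * L * (2 * (1 + c * R) * (2 * R) ^ (c - 1)) with hM
  have hM0 : 0 ≤ M := by positivity
  refine ⟨2 * (1 + L) + M, by positivity, fun z η hη hz hKz => ?_⟩
  by_cases h : ∃ j : Fin c, ‖z‖ ≤ 2 * L * |inner ℝ (e (Fin.castLE hca j)) z|
  · obtain ⟨j, hj⟩ := h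
    have hu : 0 < |inner ℝ (e (Fin.castLE hca j)) z| :=
      pos_of_mul_pos_right (hz.trans_le hj) (by positivity)
    refine (measure_mono ?_).trans <| (volume_matrix_slab_le (m := a - c)
      (fun j => inner ℝ (e (Fin.castLE hca j)) z) j (abs_pos.1 hu)
      (fun i => inner ℝ (e ⟨c + i.1, by have := i.2; omega⟩) z)
      (ε := (1 + c * R) * η) (by positivity) hR).trans ?_
    · rintro Θ ⟨h1, h2⟩
      exact ⟨h1, (of_infDist_graphSub_le he hR h1 h2).1⟩
    · refine pow_le_pow_left' (ENNReal.ofReal_le_ofReal ?_) _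
      have hinv : |inner ℝ (e (Fin.castLE hca j)) z|⁻¹ ≤ 2 * L * ‖z‖⁻¹ := by
        rw [← div_eq_mul_inv, inv_le_comm₀ hu (by positivity), inv_div, div_le_iff₀ (by positivity)]
        linarith
      calc |inner ℝ (e (Fin.castLE hca j)) z|⁻¹ * (2 * ((1 + c * R) * η) * (2 * R) ^ (c - 1))
          ≤ 2 * L * ‖z‖⁻¹ * (2 * ((1 + c * R) * η) * (2 * R) ^ (c - 1)) := by gcongr
        _ = M * (η / ‖z‖) := by rw [hM]; ring
        _ ≤ _ := by
          gcongr
          linarith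
  · push Not at h
    refine (measure_mono (t := ∅) ?_).trans (by simp)
    rintro Θ ⟨h1, h2⟩
    have h3 := (of_infDist_graphSub_le he hR h1 h2).2
    have h4 : L * η + (1 + (a - c : ℕ) * R) * ∑ j, |inner ℝ (e (Fin.castLE hca j)) z| =
        (1 + (a - c : ℕ) * R) * ∑ j, (|inner ℝ (e (Fin.castLE hca j)) z| + η) := by
      rw [Finset.sum_add_distrib, hL]
      simp
      ring
    have h5 : ∑ j : Fin c, 2 * L * |inner ℝ (e (Fin.castLE hca j)) z| < ∑ _j : Fin c, ‖z‖ :=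
      Finset.sum_lt_sum_of_nonempty ⟨⟨0, hc⟩, Finset.mem_univ _⟩ fun j _ => h j
    rw [← Finset.mul_sum, Finset.sum_const, Finset.card_univ, Fintype.card_fin, nsmul_eq_mul] at h5
    set S := ∑ j : Fin c, |inner ℝ (e (Fin.castLE hca j)) z|
    have h6 : 2 * ((1 + (a - c : ℕ) * R) * S) < ‖z‖ := by
      refine lt_of_mul_lt_mul_left (a := (c : ℝ)) ?_ hc'.le
      calc (c : ℝ) * (2 * ((1 + (a - c : ℕ) * R) * S)) = 2 * L * S := by rw [hL]; ring
        _ < _ := h5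
    have h7 : 0 ≤ M * η := by positivity
    linarith

lemma exists_rpow_le_mul_rpow {f : ℕ → ℝ} {c₁ c₂ : ℝ} (hc₁ : 0 < c₁)
    (h₁ : ∀ k : ℕ, c₁ * ((k : ℝ) + 1) ≤ f k) (h₂ : ∀ k : ℕ, f k ≤ c₂ * ((k : ℝ) + 1)) (p : ℝ) :
    ∃ K : ℝ, 0 < K ∧ ∀ k : ℕ, f k ^ p ≤ K * ((k : ℝ) + 1) ^ p := by
  have hf : ∀ k, 0 < f k := fun k => lt_of_lt_of_le (by positivity) (h₁ k)
  have hc₂ : 0 < c₂ := by simpa using (hf 0).trans_le (h₂ 0)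
  rcases le_total 0 p with hp | hp
  · refine ⟨c₂ ^ p, by positivity, fun k => ?_⟩
    rw [← Real.mul_rpow hc₂.le (by positivity)]
    exact Real.rpow_le_rpow (hf k).le (h₂ k) hp
  · refine ⟨c₁ ^ p, by positivity, fun k => ?_⟩
    rw [← Real.mul_rpow hc₁.le (by positivity)]
    exact Real.rpow_le_rpow_of_nonpos (by positivity) (h₁ k) hp

lemma exists_log_two_pow_add_two_rpow_le (p : ℝ) :
    ∃ K : ℝ, 0 < K ∧ ∀ k : ℕ, Real.log ((2 : ℝ) ^ k + 2) ^ p ≤ K * ((k : ℝ) + 1) ^ p := by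
  have hl : 0 < Real.log 2 := Real.log_pos one_lt_two
  refine exists_rpow_le_mul_rpow (c₁ := Real.log 2 / 2) (c₂ := 2 * Real.log 2) (by positivity)
    (fun k => ?_) (fun k => ?_) p
  · rcases Nat.eq_zero_or_pos k with rfl | hk
    · have : Real.log 2 ≤ Real.log ((2 : ℝ) ^ 0 + 2) := Real.log_le_log (by norm_num) (by norm_num)
      norm_num at this ⊢
      linarith
    · have h1 : k * Real.log 2 ≤ Real.log ((2 : ℝ) ^ k + 2) := by
        rw [← Real.log_pow]
        exact Real.log_le_log (by positivity) (by linarith)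
      have hk' : (1 : ℝ) ≤ k := by exact_mod_cast hk
      nlinarith
  · have h1 : Real.log ((2 : ℝ) ^ k + 2) ≤ (k + 2 : ℕ) * Real.log 2 := by
      rw [← Real.log_pow]
      refine Real.log_le_log (by positivity) ?_
      have : (1 : ℝ) ≤ 2 ^ k := one_le_pow₀ one_le_two
      rw [pow_add]
      linarith
    push_cast at h1
    nlinarith [(Nat.cast_nonneg k : (0 : ℝ) ≤ k)]

lemma exists_log_four_mul_two_pow_add_two_rpow_le (p : ℝ) :
    ∃ K : ℝ, 0 < K ∧ ∀ k : ℕ, Real.log (4 * (2 : ℝ) ^ k + 2) ^ p ≤ K * ((k : ℝ) + 1) ^ p := by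
  have hl : 0 < Real.log 2 := Real.log_pos one_lt_two
  refine exists_rpow_le_mul_rpow (c₁ := Real.log 2) (c₂ := 3 * Real.log 2) hl
    (fun k => ?_) (fun k => ?_) p
  · have h1 : (k + 1 : ℕ) * Real.log 2 ≤ Real.log (4 * (2 : ℝ) ^ k + 2) := by
      rw [← Real.log_pow]
      refine Real.log_le_log (by positivity) ?_
      have : (0 : ℝ) < 2 ^ k := by positivity
      rw [pow_succ]
      linarith
    push_cast at h1
    linarith
  · have h1 : Real.log (4 * (2 : ℝ) ^ k + 2) ≤ (k + 3 : ℕ) * Real.log 2 := by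
      rw [← Real.log_pow]
      refine Real.log_le_log (by positivity) ?_
      have : (1 : ℝ) ≤ 2 ^ k := one_le_pow₀ one_le_two
      rw [pow_add]
      linarith
    push_cast at h1
    nlinarith [(Nat.cast_nonneg k : (0 : ℝ) ≤ k)]

lemma summable_two_pow_rpow_mul_rpow {σ τ : ℝ} (h : σ < 0 ∨ σ = 0 ∧ τ < -1) :
    Summable fun k : ℕ => ((2 : ℝ) ^ k) ^ σ * ((k : ℝ) + 1) ^ τ := by
  rcases h with hσ | ⟨rfl, hτ⟩
  · set r : ℝ := 2 ^ σ
    have hr0 : 0 < r := by positivity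
    have hr1 : r < 1 := Real.rpow_lt_one_of_one_lt_of_neg one_lt_two hσ
    set q := ⌈τ⌉₊
    have hs := (summable_nat_add_iff 1).2
      (summable_pow_mul_geometric_of_norm_lt_one q (r := r) (by rwa [Real.norm_of_nonneg hr0.le]))
    refine Summable.of_nonneg_of_le (fun k => by positivity) (fun k => ?_) (hs.mul_left r⁻¹)
    have h1 : ((2 : ℝ) ^ k) ^ σ = r ^ k := by
      rw [← Real.rpow_natCast, ← Real.rpow_mul two_pos.le, mul_comm, Real.rpow_mul_natCast two_pos.le]
    have h2 : ((k : ℝ) + 1) ^ τ ≤ ((k : ℝ) + 1) ^ q := by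
      rw [← Real.rpow_natCast]
      exact Real.rpow_le_rpow_of_exponent_le (by linarith [(Nat.cast_nonneg k : (0 : ℝ) ≤ k)])
        (Nat.le_ceil τ)
    calc ((2 : ℝ) ^ k) ^ σ * ((k : ℝ) + 1) ^ τ ≤ r ^ k * ((k : ℝ) + 1) ^ q := by
          rw [h1]
          gcongr
      _ = _ := by
          push_cast
          rw [pow_succ]
          field_simp
  · simpa using (summable_nat_add_iff 1).2 (Real.summable_nat_rpow.2 hτ)

lemma summable_dyadic {β γ B₀ C₀ : ℝ} {n m : ℕ}
    (h : n * (1 + β) - m * (1 + γ) < 0 ∨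
      n * (1 + β) - m * (1 + γ) = 0 ∧ C₀ * m - B₀ * n < -1) :
    Summable fun k : ℕ =>
      ((2 : ℝ) ^ k / ((4 * (2 : ℝ) ^ k) ^ (-β) * Real.log (4 * (2 : ℝ) ^ k + 2) ^ B₀)) ^ n *
        (((2 : ℝ) ^ k) ^ (-γ) * Real.log ((2 : ℝ) ^ k + 2) ^ C₀ / (2 : ℝ) ^ k) ^ m := by
  obtain ⟨K₁, hK₁, h₁⟩ := exists_log_four_mul_two_pow_add_two_rpow_le (-B₀ * n)
  obtain ⟨K₂, hK₂, h₂⟩ := exists_log_two_pow_add_two_rpow_le (C₀ * m)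
  have hlog4 : ∀ k : ℕ, 0 < Real.log (4 * (2 : ℝ) ^ k + 2) := fun k =>
    Real.log_pos (by linarith [(by positivity : (0 : ℝ) < 2 ^ k)])
  have hlog1 : ∀ k : ℕ, 0 < Real.log ((2 : ℝ) ^ k + 2) := fun k =>
    Real.log_pos (by linarith [(by positivity : (0 : ℝ) < 2 ^ k)])
  refine Summable.of_nonneg_of_le (fun k => ?_) (fun k => ?_)
    ((summable_two_pow_rpow_mul_rpow h).mul_left (((4 : ℝ) ^ β) ^ n * K₁ * K₂))
  · have := hlog4 k
    have := hlog1 k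
    positivity
  set N : ℝ := 2 ^ k
  have hN : 0 < N := by positivity
  have hl4 : 0 < Real.log (4 * N + 2) := hlog4 k
  have hl1 : 0 < Real.log (N + 2) := hlog1 k
  have hk : (0 : ℝ) < k + 1 := by positivity
  have e1 : (N / ((4 * N) ^ (-β) * Real.log (4 * N + 2) ^ B₀)) ^ n =
      ((4 : ℝ) ^ β) ^ n * N ^ ((1 + β) * n) * Real.log (4 * N + 2) ^ (-B₀ * n) := by
    rw [Real.rpow_mul_natCast hN.le, Real.rpow_mul_natCast hl4.le, ← mul_pow, ← mul_pow,
      Real.mul_rpow (by norm_num) hN.le, Real.rpow_add hN, Real.rpow_one, Real.rpow_neg hl4.le,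
      Real.rpow_neg hN.le, Real.rpow_neg (by norm_num : (0 : ℝ) ≤ 4)]
    congr 1
    have : 0 < Real.log (4 * N + 2) ^ B₀ := by positivity
    field_simp
  have e2 : (N ^ (-γ) * Real.log (N + 2) ^ C₀ / N) ^ m =
      N ^ (-((1 + γ) * m)) * Real.log (N + 2) ^ (C₀ * m) := by
    rw [← neg_mul, Real.rpow_mul_natCast hN.le, Real.rpow_mul_natCast hl1.le, ← mul_pow,
      neg_add, Real.rpow_add hN, Real.rpow_neg_one]
    congr 1
    field_simp
  rw [e1, e2]
  calc _ = ((4 : ℝ) ^ β) ^ n * (N ^ ((1 + β) * n) * N ^ (-((1 + γ) * m))) *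
        (Real.log (4 * N + 2) ^ (-B₀ * n) * Real.log (N + 2) ^ (C₀ * m)) := by ring
    _ ≤ ((4 : ℝ) ^ β) ^ n * (N ^ ((1 + β) * n) * N ^ (-((1 + γ) * m))) *
        ((K₁ * ((k : ℝ) + 1) ^ (-B₀ * n)) * (K₂ * ((k : ℝ) + 1) ^ (C₀ * m))) := by
      have := h₁ k
      have := h₂ k
      gcongr
    _ = ((4 : ℝ) ^ β) ^ n * K₁ * K₂ * ((N ^ ((1 + β) * n) * N ^ (-((1 + γ) * m))) *
        (((k : ℝ) + 1) ^ (C₀ * m) * ((k : ℝ) + 1) ^ (-B₀ * n))) := by ring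
    _ = _ := by
      rw [← Real.rpow_add hN, ← Real.rpow_add hk]
      ring_nf

lemma infDist_sub_le {E : Type*} [NormedAddCommGroup E] [InnerProductSpace ℝ E]
    [FiniteDimensional ℝ E] (A : Submodule ℝ E) (x y : E) :
    Metric.infDist (x - y) (A : Set E) ≤
      Metric.infDist x (A : Set E) + Metric.infDist y (A : Set E) := by
  obtain ⟨p, hp, hxp⟩ := IsClosed.exists_infDist_eq_dist
    (Submodule.closed_of_finiteDimensional A) ⟨0, zero_mem _⟩ x
  obtain ⟨q, hq, hyq⟩ := IsClosed.exists_infDist_eq_dist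
    (Submodule.closed_of_finiteDimensional A) ⟨0, zero_mem _⟩ y
  rw [hxp, hyq]
  exact (Metric.infDist_le_dist_of_mem (A.sub_mem hp hq)).trans (dist_sub_sub_le x y p q)

/-- Counting integer points of size about `N` near `A` when nonzero integer points of size at most
`4 * N` stay away from `B ≤ A`. -/
lemma card_intVec_near_le {d n : ℕ} {A B : Submodule ℝ (EuclideanSpace ℝ (Fin d))} (hBA : B ≤ A)
    (hn : Module.finrank ℝ B + n = Module.finrank ℝ A) (hn0 : 0 < n) {N δ η : ℝ} (hN : 1 ≤ N)
    (hδ : 0 < δ) (hδ1 : δ ≤ 1) (hηδ : 4 * η ≤ δ)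
    (hsep : ∀ z : Fin d → ℤ, z ≠ 0 → supNorm (intVec z) ≤ 4 * N →
      δ ≤ Metric.infDist (intVec z) (B : Set (EuclideanSpace ℝ (Fin d))))
    (S : Finset (Fin d → ℤ)) (hS : ∀ z ∈ S, supNorm (intVec z) ≤ 2 * N ∧
      Metric.infDist (intVec z) (A : Set (EuclideanSpace ℝ (Fin d))) ≤ η) :
    (S.card : ℝ) ≤ ((8 * d * n + 3) * (N / δ)) ^ n := by
  obtain ⟨w, hw1, hw⟩ := exists_infDist_le_infDist_add_sum hBA hn
  have hn' : (0 : ℝ) < n := by exact_mod_cast hn0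
  have hcard := card_le_of_separated S (fun z i => inner ℝ (w i) (intVec z))
    (R := d * (2 * N)) (s := δ / (2 * n)) (by positivity) (by positivity)
    (fun z hz i => by
      refine (abs_real_inner_le_norm _ _).trans ?_
      rw [hw1, one_mul]
      refine (norm_le_mul_supNorm _).trans ?_
      gcongr
      exact (hS z hz).1)
    (fun z hz z' hz' h => by
      by_contra hne
      have h1 := hsep (z - z') (sub_ne_zero.2 hne) (by
        rw [intVec_sub]
        linarith [supNorm_sub_le (intVec z) (intVec z'), (hS z hz).1, (hS z' hz').1])
      rw [intVec_sub] at h1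
      have h2 := hw (intVec z - intVec z')
      have h3 := infDist_sub_le A (intVec z) (intVec z')
      have h4 : ∑ i, |inner ℝ (w i) (intVec z - intVec z')| < ∑ _i : Fin n, δ / (2 * n) :=
        Finset.sum_lt_sum_of_nonempty ⟨⟨0, hn0⟩, Finset.mem_univ _⟩ fun i _ => by
          rw [inner_sub_right]
          exact h i
      have h5 : ∑ _i : Fin n, δ / (2 * n) = δ / 2 := by
        simp
        field_simp
      linarith [(hS z hz).2, (hS z' hz').2])
  refine hcard.trans (pow_le_pow_left₀ (by positivity) ?_ _)
  have h1 : 1 ≤ N / δ := by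
    rw [le_div_iff₀ hδ]
    linarith
  have h2 : 2 * (d * (2 * N) / (δ / (2 * n))) = 8 * d * n * (N / δ) := by
    field_simp
    ring
  rw [h2]
  linarith

lemma ae_eventually_lt_infDist_graphSub {d a c n : ℕ} (hc : 1 ≤ c) (hca : c < a)
    (hnm : a - c ≤ n) {A B : Submodule ℝ (EuclideanSpace ℝ (Fin d))} (hBA : B ≤ A)
    (hn : Module.finrank ℝ B + n = Module.finrank ℝ A)
    {e : Fin a → EuclideanSpace ℝ (Fin d)} (he : Orthonormal ℝ e)
    (hspan : Submodule.span ℝ (Set.range e) = A) {η δ : ℕ → ℝ} (hη : ∀ k, 0 ≤ η k)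
    (hδ : ∀ k, 0 < δ k) (hδ1 : ∀ k, δ k ≤ 1)
    (hsum : Summable fun k : ℕ => ((2 : ℝ) ^ k / δ k) ^ n * (η k / (2 : ℝ) ^ k) ^ (a - c))
    (hsep : ∀ (k : ℕ) (z : Fin d → ℤ), z ≠ 0 → supNorm (intVec z) ≤ 4 * 2 ^ k →
      δ k ≤ Metric.infDist (intVec z) (B : Set (EuclideanSpace ℝ (Fin d))))
    {R : ℝ} (hR : 0 ≤ R) :
    ∀ᵐ Θ ∂(volume : Measure (Fin (a - c) → Fin c → ℝ)), (∀ i j, |Θ i j| ≤ R) →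
      ∀ᶠ k in atTop, ∀ z : Fin d → ℤ, 2 ^ k ≤ supNorm (intVec z) →
        supNorm (intVec z) ≤ 2 * 2 ^ k → η k < Metric.infDist (intVec z)
          (graphSub d a c hca.le e Θ : Set (EuclideanSpace ℝ (Fin d))) := by
  have hm0 : a - c ≠ 0 := by omega
  obtain ⟨K, hK, hvol⟩ := exists_volume_infDist_graphSub_le hc hca.le he hR
  set m := a - c with hm
  set t : ℕ → ℝ := fun k => ((2 : ℝ) ^ k / δ k) ^ n * (η k / (2 : ℝ) ^ k) ^ m
  have hsmall : ∀ᶠ k in atTop, 4 * η k ≤ δ k ∧ K ≤ (2 : ℝ) ^ k := by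
    refine Eventually.and ?_ ((tendsto_pow_atTop_atTop_of_one_lt one_lt_two).eventually_ge_atTop K)
    have h4 : (0 : ℝ) < (1 / 4) ^ m := by positivity
    filter_upwards [hsum.tendsto_atTop_zero.eventually_lt_const h4] with k hk
    have hδk := hδ k
    have hηk := hη k
    have h1 : (1 : ℝ) ≤ 2 ^ k / δ k := by
      rw [le_div_iff₀ hδk]
      linarith [hδ1 k, (one_le_pow₀ one_le_two : (1 : ℝ) ≤ 2 ^ k)]
    have h2 : (η k / δ k) ^ m ≤ t k := by
      calc (η k / δ k) ^ m = (2 ^ k / δ k) ^ m * (η k / 2 ^ k) ^ m := by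
            rw [← mul_pow]
            congr 1
            field_simp
        _ ≤ t k := mul_le_mul_of_nonneg_right (pow_le_pow_right₀ h1 hnm) (by positivity)
    have h3 := lt_of_pow_lt_pow_left₀ m (by norm_num) (h2.trans_lt hk)
    rw [div_lt_iff₀ hδk] at h3
    linarith
  obtain ⟨k₀, hk₀⟩ := eventually_atTop.1 hsmall
  let F : ℕ → Set (Fin m → Fin c → ℝ) := fun k => {Θ | (∀ i j, |Θ i j| ≤ R) ∧
    ∃ z : Fin d → ℤ, 2 ^ k ≤ supNorm (intVec z) ∧ supNorm (intVec z) ≤ 2 * 2 ^ k ∧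
      Metric.infDist (intVec z)
        (graphSub d a c hca.le e Θ : Set (EuclideanSpace ℝ (Fin d))) ≤ η k}
  have hF : ∀ k, k₀ ≤ k →
      volume (F k) ≤ ENNReal.ofReal ((8 * d * n + 3) ^ n * K ^ m * t k) := by
    intro k hk
    obtain ⟨hηδ, hKk⟩ := hk₀ k hk
    have hN1 : (1 : ℝ) ≤ 2 ^ k := one_le_pow₀ one_le_two
    have hδk := hδ k
    have hηk := hη k
    have hfin : {z : Fin d → ℤ | 2 ^ k ≤ supNorm (intVec z) ∧ supNorm (intVec z) ≤ 2 * 2 ^ k ∧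
        Metric.infDist (intVec z) (A : Set (EuclideanSpace ℝ (Fin d))) ≤ η k}.Finite :=
      (finite_setOf_supNorm_intVec_le d (2 * 2 ^ k)).subset fun z hz => hz.2.1
    have hcard := card_intVec_near_le hBA hn (by omega) hN1 (hδ k) (hδ1 k) hηδ (hsep k)
      hfin.toFinset (fun z hz => (hfin.mem_toFinset.1 hz).2)
    have hcover : F k ⊆ ⋃ z ∈ hfin.toFinset, {Θ | (∀ i j, |Θ i j| ≤ R) ∧
        Metric.infDist (intVec z)
          (graphSub d a c hca.le e Θ : Set (EuclideanSpace ℝ (Fin d))) ≤ η k} := by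
      rintro Θ ⟨hΘ, z, hz1, hz2, hz3⟩
      simp only [Set.mem_iUnion]
      refine ⟨z, hfin.mem_toFinset.2 ⟨hz1, hz2, ?_⟩, hΘ, hz3⟩
      refine (Metric.infDist_le_infDist_of_subset ?_ ⟨0, zero_mem _⟩).trans hz3
      rw [← hspan]
      exact graphSub_le_span ..
    calc volume (F k) ≤ ∑ z ∈ hfin.toFinset, volume {Θ : Fin m → Fin c → ℝ |
          (∀ i j, |Θ i j| ≤ R) ∧ Metric.infDist (intVec z)
            (graphSub d a c hca.le e Θ : Set (EuclideanSpace ℝ (Fin d))) ≤ η k} :=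
          (measure_mono hcover).trans (measure_biUnion_finset_le _ _)
      _ ≤ ∑ z ∈ hfin.toFinset, ENNReal.ofReal ((K * (η k / 2 ^ k)) ^ m) := by
          refine Finset.sum_le_sum fun z hz => ?_
          have hz' : 2 ^ k ≤ ‖intVec z‖ :=
            (hfin.mem_toFinset.1 hz).1.trans (supNorm_le_norm _)
          refine (hvol (intVec z) (η k) hηk (by linarith) ?_).trans ?_
          · nlinarith [hδ1 k]
          · rw [← ENNReal.ofReal_pow (by positivity)]
            gcongr
      _ = ENNReal.ofReal (hfin.toFinset.card * (K * (η k / 2 ^ k)) ^ m) := by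
          rw [Finset.sum_const, nsmul_eq_mul, ENNReal.ofReal_mul (by positivity),
            ENNReal.ofReal_natCast]
      _ ≤ _ := by
          refine ENNReal.ofReal_le_ofReal ?_
          calc _ ≤ ((8 * d * n + 3) * (2 ^ k / δ k)) ^ n * (K * (η k / 2 ^ k)) ^ m := by gcongr
            _ = _ := by
              simp only [t, mul_pow]
              ring
  have htsum : ∑' k, volume (F (k + k₀)) ≠ ⊤ := by
    have hs := (summable_nat_add_iff k₀).2 (hsum.mul_left ((8 * d * n + 3) ^ n * K ^ m))
    exact ne_top_of_le_ne_top hs.tsum_ofReal_ne_top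
      (ENNReal.tsum_le_tsum fun k => hF _ (Nat.le_add_left _ _))
  filter_upwards [ae_eventually_notMem htsum] with Θ hΘ hΘR
  obtain ⟨k₁, hk₁⟩ := eventually_atTop.1 hΘ
  filter_upwards [eventually_ge_atTop (k₁ + k₀)] with k hk z hz1 hz2
  by_contra! hcon
  have := hk₁ (k - k₀) (by omega)
  rw [Nat.sub_add_cancel (by omega)] at this
  exact this ⟨hΘR, z, hz1, hz2, hcon⟩

lemma ae_infDist_graphSub_pos {d a c : ℕ} (hc : 1 ≤ c) (hca : c < a)
    {e : Fin a → EuclideanSpace ℝ (Fin d)} (he : Orthonormal ℝ e) {R : ℝ} (hR : 0 ≤ R) :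
    ∀ᵐ Θ ∂(volume : Measure (Fin (a - c) → Fin c → ℝ)), (∀ i j, |Θ i j| ≤ R) →
      ∀ z : Fin d → ℤ, z ≠ 0 → 0 < Metric.infDist (intVec z)
          (graphSub d a c hca.le e Θ : Set (EuclideanSpace ℝ (Fin d))) := by
  obtain ⟨K, hK, hvol⟩ := exists_volume_infDist_graphSub_le hc hca.le he hR
  have h : ∀ z : Fin d → ℤ, ∀ᵐ Θ ∂(volume : Measure (Fin (a - c) → Fin c → ℝ)),
      (∀ i j, |Θ i j| ≤ R) → z ≠ 0 → 0 < Metric.infDist (intVec z)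
          (graphSub d a c hca.le e Θ : Set (EuclideanSpace ℝ (Fin d))) := by
    intro z
    by_cases hz : z = 0
    · simp [hz]
    have hz1 : 0 < ‖intVec z‖ :=
      one_pos.trans_le ((one_le_supNorm_intVec hz).trans (supNorm_le_norm _))
    have h0 := hvol (intVec z) 0 le_rfl hz1 (by simp)
    rw [zero_div, mul_zero, ENNReal.ofReal_zero, zero_pow (by omega)] at h0
    refine measure_mono_null (fun Θ hΘ => ?_) (le_antisymm h0 zero_le)
    simp only [Set.mem_compl_iff, Set.mem_ofPred_eq, Classical.not_imp, not_lt] at hΘ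
    exact ⟨hΘ.1, hΘ.2.2⟩
  filter_upwards [ae_all_iff.2 h] with Θ hΘ hΘR z hz using hΘ z hΘR hz

lemma exists_pos_mul_le_of_finite {ι : Type*} {s : Set ι} (hs : s.Finite) (f : ι → ℝ)
    {g : ι → ℝ} (hg : ∀ z ∈ s, 0 < g z) : ∃ ρ : ℝ, 0 < ρ ∧ ρ ≤ 1 ∧ ∀ z ∈ s, ρ * f z ≤ g z := by
  have h1 : ∀ᶠ ρ in nhdsWithin (0 : ℝ) (Set.Ioi 0), ∀ z ∈ s, ρ * f z ≤ g z := by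
    refine (eventually_all_finite hs).2 fun z hz => ?_
    have : Tendsto (fun ρ : ℝ => ρ * f z) (nhds 0) (nhds (0 * f z)) :=
      (continuous_mul_const (f z)).tendsto 0
    rw [zero_mul] at this
    exact ((this.mono_left nhdsWithin_le_nhds).eventually_lt_const (hg z hz)).mono
      fun _ h => h.le
  have h2 : ∀ᶠ ρ in nhdsWithin (0 : ℝ) (Set.Ioi 0), ρ ≤ 1 :=
    nhdsWithin_le_nhds (Iic_mem_nhds one_pos)
  obtain ⟨ρ, ⟨hρ1, hρ2⟩, hρ3⟩ := ((h1.and h2).and self_mem_nhdsWithin).exists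
  exact ⟨ρ, hρ3, hρ2, hρ1⟩

/-- let `1 ≤ b ≤ c < a ≤ d`, `b < d`, `0 < β ≤ γ`,
`ψ(T) = T^{−β} log(T+2)^{B₀}`, `φ(T) = T^{−γ} log(T+2)^{C₀}`, with `ψ, φ` decreasing on
`[1,∞)` and `ψ(T) ≤ T^{−b/(d−b)}`. If `B ⊆ ℝ^d` is a `b`-dimensional `ψ`-badly approximable
subspace, `A ⊇ B` is `a`-dimensional, and `γ(a−c) > β(a−b)+c−b`, or `γ(a−c) = β(a−b)+c−b` and
`C₀(a−c) − B₀(a−b) < −1`, then for almost every `Θ` only finitely many nonzero `z ∈ ℤ^d`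
satisfy `dist(z, C(Θ)) < φ(|z|)`; hence `C(Θ)` is `ρφ`-badly approximable for some `ρ > 0`. -/
theorem stmt_17 (d a b c : ℕ) (hb : 1 ≤ b) (hbc : b ≤ c) (hca : c < a) (had : a ≤ d)
    (hbd : b < d)
    (β γ B₀ C₀ : ℝ) (hβpos : 0 < β) (hβγ : β ≤ γ)
    (hψanti : AntitoneOn (fun T : ℝ => T ^ (-β) * Real.log (T + 2) ^ B₀) (Set.Ici 1))
    (hφanti : AntitoneOn (fun T : ℝ => T ^ (-γ) * Real.log (T + 2) ^ C₀) (Set.Ici 1))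
    (hψbound : ∀ T : ℝ, 1 ≤ T →
      T ^ (-β) * Real.log (T + 2) ^ B₀ ≤ T ^ (-(b : ℝ) / ((d : ℝ) - (b : ℝ))))
    (B A : Submodule ℝ (EuclideanSpace ℝ (Fin d))) (hBA : B ≤ A)
    (hdimB : Module.finrank ℝ B = b) (hdimA : Module.finrank ℝ A = a)
    (hbad : ∀ z : Fin d → ℤ, z ≠ 0 →
      supNorm (intVec z) ^ (-β) * Real.log (supNorm (intVec z) + 2) ^ B₀ ≤
        Metric.infDist (intVec z) (B : Set (EuclideanSpace ℝ (Fin d))))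
    (e : Fin a → EuclideanSpace ℝ (Fin d)) (he : Orthonormal ℝ e)
    (hspan : Submodule.span ℝ (Set.range e) = A)
    (hcond :
      γ * ((a : ℝ) - (c : ℝ)) > β * ((a : ℝ) - (b : ℝ)) + (c : ℝ) - (b : ℝ) ∨
      (γ * ((a : ℝ) - (c : ℝ)) = β * ((a : ℝ) - (b : ℝ)) + (c : ℝ) - (b : ℝ) ∧
        C₀ * ((a : ℝ) - (c : ℝ)) - B₀ * ((a : ℝ) - (b : ℝ)) < -1)) :
    ∀ᵐ Θ ∂(volume : Measure (Fin (a - c) → Fin c → ℝ)),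
      {z : Fin d → ℤ | z ≠ 0 ∧
          Metric.infDist (intVec z)
            ((graphSub d a c hca.le e Θ : Submodule ℝ (EuclideanSpace ℝ (Fin d))) :
              Set (EuclideanSpace ℝ (Fin d))) <
            supNorm (intVec z) ^ (-γ) * Real.log (supNorm (intVec z) + 2) ^ C₀}.Finite ∧
      ∃ ρ : ℝ, 0 < ρ ∧ ∀ z : Fin d → ℤ, z ≠ 0 →
        ρ * (supNorm (intVec z) ^ (-γ) * Real.log (supNorm (intVec z) + 2) ^ C₀) ≤
          Metric.infDist (intVec z)
            ((graphSub d a c hca.le e Θ : Submodule ℝ (EuclideanSpace ℝ (Fin d))) :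
              Set (EuclideanSpace ℝ (Fin d))) := by
  have hpos : ∀ (T p q : ℝ), 1 ≤ T → 0 < T ^ p * Real.log (T + 2) ^ q := fun T p q hT => by
    have : 0 < Real.log (T + 2) := Real.log_pos (by linarith)
    have : 0 < T := by linarith
    positivity
  have hN1 : ∀ k : ℕ, (1 : ℝ) ≤ 2 ^ k := fun k => one_le_pow₀ one_le_two
  have hcast1 : ((a - b : ℕ) : ℝ) = (a : ℝ) - b := Nat.cast_sub (by omega)
  have hcast2 : ((a - c : ℕ) : ℝ) = (a : ℝ) - c := Nat.cast_sub (by omega)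
  have hsum := summable_dyadic (β := β) (γ := γ) (B₀ := B₀) (C₀ := C₀) (n := a - b) (m := a - c)
    (by
      rw [hcast1, hcast2]
      rcases hcond with h | ⟨h1, h2⟩
      · left; linarith
      · right; exact ⟨by linarith, h2⟩)
  have hev : ∀ R : ℕ, _ := fun R => ae_eventually_lt_infDist_graphSub (hb.trans hbc) hca
    (n := a - b) (by omega) hBA (by omega) he hspan (R := R)
    (fun k => (hpos ((2 : ℝ) ^ k) _ _ (hN1 k)).le)
    (fun k => hpos (4 * (2 : ℝ) ^ k) _ _ (by linarith [hN1 k]))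
    (fun k => (hψbound _ (by linarith [hN1 k])).trans
      (Real.rpow_le_one_of_one_le_of_nonpos (by linarith [hN1 k])
        (div_nonpos_of_nonpos_of_nonneg (by simp)
          (sub_nonneg.2 (by exact_mod_cast hbd.le))))) hsum
    (fun k z hz hzk => (hψanti (Set.mem_Ici.2 (one_le_supNorm_intVec hz))
      (Set.mem_Ici.2 (by linarith [hN1 k])) hzk).trans (hbad z hz)) (Nat.cast_nonneg R)
  have hnz : ∀ R : ℕ, _ := fun R =>
    ae_infDist_graphSub_pos (hb.trans hbc) hca he (R := R) (Nat.cast_nonneg R)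
  filter_upwards [ae_all_iff.2 hev, ae_all_iff.2 hnz] with Θ h1 h2
  obtain ⟨R, hR⟩ := exists_nat_ge ‖Θ‖
  have hΘ : ∀ i j, |Θ i j| ≤ R := fun i j =>
    ((norm_le_pi_norm (Θ i) j).trans (norm_le_pi_norm Θ i)).trans hR
  obtain ⟨k₁, hk₁⟩ := eventually_atTop.1 (h1 R hΘ)
  have hfin : {z : Fin d → ℤ | z ≠ 0 ∧
      Metric.infDist (intVec z)
        ((graphSub d a c hca.le e Θ : Submodule ℝ (EuclideanSpace ℝ (Fin d))) :
          Set (EuclideanSpace ℝ (Fin d))) <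
        supNorm (intVec z) ^ (-γ) * Real.log (supNorm (intVec z) + 2) ^ C₀}.Finite := by
    refine (finite_setOf_supNorm_intVec_le d (2 ^ k₁)).subset fun z hz => ?_
    by_contra hcon
    simp only [Set.mem_ofPred_eq, not_le] at hcon
    have hz1 := one_le_supNorm_intVec hz.1
    obtain ⟨k, hk, hk'⟩ := exists_nat_pow_near hz1 one_lt_two
    have hkk : k₁ ≤ k := by
      have := (pow_lt_pow_iff_right₀ (one_lt_two : (1 : ℝ) < 2)).1 (hcon.trans hk')
      omega
    have h3 := hk₁ k hkk z hk (by rw [pow_succ] at hk'; linarith)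
    have h4 := hφanti (Set.mem_Ici.2 (hN1 k)) (Set.mem_Ici.2 hz1) hk
    exact absurd (h3.trans hz.2) (not_lt.2 h4)
  refine ⟨hfin, ?_⟩
  obtain ⟨ρ, hρ0, hρ1, hρ⟩ := exists_pos_mul_le_of_finite hfin
    (fun z => supNorm (intVec z) ^ (-γ) * Real.log (supNorm (intVec z) + 2) ^ C₀)
    (fun z hz => h2 R hΘ z hz.1)
  refine ⟨ρ, hρ0, fun z hz => ?_⟩
  by_cases hzF : Metric.infDist (intVec z)
      ((graphSub d a c hca.le e Θ : Submodule ℝ (EuclideanSpace ℝ (Fin d))) :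
        Set (EuclideanSpace ℝ (Fin d))) <
      supNorm (intVec z) ^ (-γ) * Real.log (supNorm (intVec z) + 2) ^ C₀
  · exact hρ z ⟨hz, hzF⟩
  · exact (mul_le_of_le_one_left (hpos _ _ _ (one_le_supNorm_intVec hz)).le hρ1).trans
      (not_lt.1 hzF)

end
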